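/- arXiv:2110.05234 — 2 statements merged into one kernel-verified Lean document; each statement's English description precedes it below -/
import Mathlib

section
/- Let n ≥ 2 be an integer and let h : ℝⁿ → (Fin n → Fin n → ℝ) be a smooth matrix-valued map such that for every x: h(x) is symmetric (h(x)ᵢⱼ = h(x)ⱼᵢ), h(x) annihilates the position vector (Σⱼ h(x)ᵢⱼ·xⱼ = 0 for every i), and h(x) is trace-free (Σᵢ h(x)ᵢᵢ = 0). Then for every x ∈ ℝⁿ: (a) Σ_{i,k} xₖ·(∂ᵢ h_{ki})(x) = 0; (b) Σ_{i,j,k} xⱼ·xₖ·(∂ᵢ∂ⱼ h_{ki})(x) = 0; (c) Σ_{j,k} xⱼ·xₖ·(Δ h_{jk})(x) = 0; (d) Σ_{i,j,k} xᵢ·xⱼ·(∂ᵢ∂ₖ h_{jk})(x) = 0. -/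
/-- Partial derivative in the `i`-th coordinate direction on `EuclideanSpace ℝ (Fin n)`. -/
noncomputable def partialDeriv' {n : ℕ} (i : Fin n) (f : EuclideanSpace ℝ (Fin n) → ℝ)
    (x : EuclideanSpace ℝ (Fin n)) : ℝ :=
  fderiv ℝ f x (EuclideanSpace.single i 1)

/-- The Euclidean Laplacian: sum of second partial derivatives. -/
noncomputable def euclideanLaplacian {n : ℕ} (f : EuclideanSpace ℝ (Fin n) → ℝ)
    (x : EuclideanSpace ℝ (Fin n)) : ℝ :=
  ∑ i : Fin n, partialDeriv' i (partialDeriv' i f) x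

theorem pd_key {n : ℕ} (f : Fin n → EuclideanSpace ℝ (Fin n) → ℝ)
    (g : EuclideanSpace ℝ (Fin n) → ℝ) (hf : ∀ k, Differentiable ℝ (f k))
    (hg : ∀ x : EuclideanSpace ℝ (Fin n), ∑ k, f k x * x k = g x)
    (i : Fin n) (x : EuclideanSpace ℝ (Fin n)) :
    ∑ k, x k * partialDeriv' i (f k) x = partialDeriv' i g x - f i x := by
  have hp : ∀ k : Fin n, HasFDerivAt (fun y : EuclideanSpace ℝ (Fin n) => y k)
      (EuclideanSpace.proj k : EuclideanSpace ℝ (Fin n) →L[ℝ] ℝ) x := fun k =>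
    (EuclideanSpace.proj k : EuclideanSpace ℝ (Fin n) →L[ℝ] ℝ).hasFDerivAt
  have h1 : HasFDerivAt (fun y => ∑ k, f k y * y k) _ x :=
    HasFDerivAt.fun_sum (u := Finset.univ) fun k _ => ((hf k) x).hasFDerivAt.mul (hp k)
  have h2 : (fun y : EuclideanSpace ℝ (Fin n) => ∑ k, f k y * y k) = g := funext hg
  rw [h2] at h1
  unfold partialDeriv'
  rw [h1.fderiv]
  simp [Finset.sum_add_distrib]

/-- For a smooth symmetric, position-annihilating, trace-free two-tensor `h`
on `ℝⁿ`, the contractions `xₖ·∂ᵢh_{ki}`, `xⱼxₖ·∂ᵢ∂ⱼh_{ki}`, `xⱼxₖ·Δh_{jk}` and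
`xᵢxⱼ·∂ᵢ∂ₖh_{jk}` all vanish identically. -/
theorem stmt_16 (n : ℕ) (hn : 2 ≤ n)
    (h : EuclideanSpace ℝ (Fin n) → Fin n → Fin n → ℝ) (hsm : ContDiff ℝ (⊤ : ℕ∞) h)
    (hsymm : ∀ x i j, h x i j = h x j i)
    (hann : ∀ (x : EuclideanSpace ℝ (Fin n)) (i : Fin n), ∑ j, h x i j * x j = 0)
    (htr : ∀ x : EuclideanSpace ℝ (Fin n), ∑ i, h x i i = 0) :
    ∀ x : EuclideanSpace ℝ (Fin n),
      (∑ i, ∑ k, x k * partialDeriv' i (fun y => h y k i) x = 0) ∧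
      (∑ i, ∑ j, ∑ k, x j * x k * partialDeriv' i (partialDeriv' j (fun y => h y k i)) x = 0) ∧
      (∑ j, ∑ k, x j * x k * euclideanLaplacian (fun y => h y j k) x = 0) ∧
      (∑ i, ∑ j, ∑ k, x i * x j * partialDeriv' i (partialDeriv' k (fun y => h y j k)) x = 0) := by
  have hd : ∀ j k, ContDiff ℝ (⊤ : ℕ∞) (fun y => h y j k) := fun j k =>
    contDiff_pi.1 (contDiff_pi.1 hsm j) k
  have hd0 : ∀ j k, Differentiable ℝ (fun y => h y j k) := fun j k =>
    (hd j k).differentiable (by simp)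
  have hd1 : ∀ i j k, Differentiable ℝ (partialDeriv' i (fun y => h y j k)) := by
    intro i j k
    have h1 : ContDiff ℝ 1 (fderiv ℝ (fun y => h y j k)) :=
      (hd j k).fderiv_right (by norm_cast)
    exact (h1.differentiable (by simp)).clm_apply (differentiable_const _)
  have hsw : ∀ j k, (fun y => h y j k) = (fun y => h y k j) := fun j k =>
    funext fun y => hsymm y j k
  have A : ∀ (i j : Fin n) (x : EuclideanSpace ℝ (Fin n)),
      ∑ k, x k * partialDeriv' i (fun y => h y j k) x = - h x j i := by
    intro i j x
    have := pd_key (fun k y => h y j k) (fun _ => 0) (hd0 j) (fun x => hann x j) i x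
    rw [this]
    simp [partialDeriv']
  have B : ∀ (l i j : Fin n) (x : EuclideanSpace ℝ (Fin n)),
      ∑ k, x k * partialDeriv' l (partialDeriv' i (fun y => h y j k)) x
        = - partialDeriv' l (fun y => h y j i) x - partialDeriv' i (fun y => h y j l) x := by
    intro l i j x
    have := pd_key (fun k => partialDeriv' i (fun y => h y j k)) (fun y => - h y j i) (hd1 i j)
      (fun x => by rw [← A i j x]; exact Finset.sum_congr rfl fun k _ => mul_comm _ _) l x
    rw [this]
    simp [partialDeriv', fderiv_fun_neg]
  have T : ∀ (i : Fin n) (x : EuclideanSpace ℝ (Fin n)),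
      ∑ k, partialDeriv' i (fun y => h y k k) x = 0 := by
    intro i x
    have h1 : HasFDerivAt (fun y => ∑ k, h y k k) _ x :=
      HasFDerivAt.fun_sum (u := Finset.univ) fun k _ => ((hd0 k k) x).hasFDerivAt
    have h2 : (fun y => ∑ k, h y k k) = fun _ => (0 : ℝ) := funext htr
    rw [h2] at h1
    have h3 := congrArg (fun L => L (EuclideanSpace.single i 1))
      (h1.unique (hasFDerivAt_const (0 : ℝ) x))
    simpa [partialDeriv'] using h3
  intro x
  have a : ∑ i, ∑ k, x k * partialDeriv' i (fun y => h y k i) x = 0 := by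
    simp_rw [fun k i => hsw k i, A, Finset.sum_neg_distrib, htr, neg_zero]
  have a' : ∑ k, ∑ i, x k * partialDeriv' i (fun y => h y k i) x = 0 := by
    rw [Finset.sum_comm]; exact a
  have t : ∑ k, ∑ i, x k * partialDeriv' k (fun y => h y i i) x = 0 := by
    simp_rw [← Finset.mul_sum, T, mul_zero, Finset.sum_const_zero]
  refine ⟨a, ?_, ?_, ?_⟩
  · have : ∀ i j, ∑ k, x j * x k * partialDeriv' i (partialDeriv' j (fun y => h y k i)) x
        = - (x j * partialDeriv' i (fun y => h y j i) x)
          - x j * partialDeriv' j (fun y => h y i i) x := by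
      intro i j
      simp_rw [mul_assoc, ← Finset.mul_sum]
      rw [Finset.sum_congr rfl fun k _ => by rw [hsw k i], B i j i x, hsw i j]
      ring
    simp_rw [this, Finset.sum_sub_distrib, Finset.sum_neg_distrib, a]
    rw [Finset.sum_comm, t]; simp
  · have : ∀ j, ∑ k, x j * x k * euclideanLaplacian (fun y => h y j k) x
        = ∑ i, (-2) * (x j * partialDeriv' i (fun y => h y j i) x) := by
      intro j
      simp_rw [euclideanLaplacian, Finset.mul_sum]
      rw [Finset.sum_comm]
      refine Finset.sum_congr rfl fun i _ => ?_
      simp_rw [mul_assoc, ← Finset.mul_sum]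
      rw [B i i j x]; ring
    simp_rw [this, ← Finset.mul_sum]
    simp_rw [← Finset.mul_sum] at a'
    rw [a', mul_zero]
  · have : ∀ i, ∑ j, ∑ k, x i * x j * partialDeriv' i (partialDeriv' k (fun y => h y j k)) x
        = ∑ k, (- (x i * partialDeriv' i (fun y => h y k k) x)
          - x i * partialDeriv' k (fun y => h y i k) x) := by
      intro i
      rw [Finset.sum_comm]
      refine Finset.sum_congr rfl fun k _ => ?_
      simp_rw [mul_assoc, ← Finset.mul_sum]
      rw [Finset.sum_congr rfl fun j _ => by rw [hsw j k], B i k k x, hsw k i]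
      ring
    simp_rw [this, Finset.sum_sub_distrib, Finset.sum_neg_distrib, a', t]
    simp
end

section
/- Let n ≥ 2 be an integer and let h : ℝⁿ → (Fin n → Fin n → ℝ) be a smooth matrix-valued map such that for every x: h(x) is symmetric (h(x)ᵢⱼ = h(x)ⱼᵢ), Σⱼ h(x)ᵢⱼ·xⱼ = 0 for every i, and Σᵢ h(x)ᵢᵢ = 0. Define F(x) = Σ_{i,j} (∂ᵢ∂ⱼ h_{ij})(x). Then for every radius r > 0 and every index l ∈ Fin n, all of the following integrals over the open ball B_r(0) (with respect to Lebesgue measure) vanish: ∫_{B_r} F(x) dx = 0, ∫_{B_r} x_l·F(x) dx = 0, ∫_{B_r} (Σₖ xₖ·(∂ₖF)(x)) dx = 0, ∫_{B_r} x_l·(Σₖ xₖ·(∂ₖF)(x)) dx = 0, ∫_{B_r} (ΔF)(x) dx = 0, and ∫_{B_r} x_l·(ΔF)(x) dx = 0. (Since these hold for every r > 0, the functions F, Σₖ xₖ·∂ₖF, and ΔF are L²-orthogonal to the functions 1, x₁, …, xₙ on every sphere centered at the origin.) -/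
open MeasureTheory

abbrev Sm17 {n : ℕ} (f : EuclideanSpace ℝ (Fin n) → ℝ) : Prop := ContDiff ℝ (⊤ : ℕ∞) f

section
variable {n : ℕ}

lemma sm_pd {f : EuclideanSpace ℝ (Fin n) → ℝ} (hf : Sm17 f) (i : Fin n) : Sm17 (partialDeriv' i f) := by
  unfold partialDeriv'
  exact (hf.fderiv_right (m := (⊤ : ℕ∞)) (by simp)).clm_apply contDiff_const

lemma sm_coord (l : Fin n) : Sm17 (fun x : EuclideanSpace ℝ (Fin n) => x l) := by
  unfold Sm17; fun_prop

lemma cs_pd {f : EuclideanSpace ℝ (Fin n) → ℝ} (hf : HasCompactSupport f) (i : Fin n) :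
    HasCompactSupport (partialDeriv' i f) :=
  hf.fderiv_apply (𝕜 := ℝ) _

lemma pd_mul {f g : EuclideanSpace ℝ (Fin n) → ℝ} (hf : Sm17 f) (hg : Sm17 g) (i : Fin n) :
    partialDeriv' i (fun x => f x * g x) = fun x => partialDeriv' i f x * g x + f x * partialDeriv' i g x := by
  funext x
  unfold partialDeriv'
  rw [fderiv_fun_mul (hf.differentiable (by simp) x) (hg.differentiable (by simp) x)]
  simp; ring

lemma pd_add {f g : EuclideanSpace ℝ (Fin n) → ℝ} (hf : Sm17 f) (hg : Sm17 g) (i : Fin n) :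
    partialDeriv' i (fun x => f x + g x) = fun x => partialDeriv' i f x + partialDeriv' i g x := by
  funext x
  unfold partialDeriv'
  rw [fderiv_fun_add (hf.differentiable (by simp) x) (hg.differentiable (by simp) x)]
  simp

lemma pd_const (c : ℝ) (i : Fin n) :
    partialDeriv' i (fun _ : EuclideanSpace ℝ (Fin n) => c) = fun _ => 0 := by
  funext x
  unfold partialDeriv'
  simp

lemma pd_coord (l i : Fin n) :
    partialDeriv' i (fun x : EuclideanSpace ℝ (Fin n) => x l) = fun _ => if i = l then 1 else 0 := by
  funext x
  unfold partialDeriv'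
  have : HasFDerivAt (fun x : EuclideanSpace ℝ (Fin n) => x l) (EuclideanSpace.proj l : EuclideanSpace ℝ (Fin n) →L[ℝ] ℝ) x :=
    (EuclideanSpace.proj (𝕜 := ℝ) l).hasFDerivAt
  rw [this.fderiv]
  simp [eq_comm]

/-- radial functions -/
noncomputable def rad17 (ψ : ℝ → ℝ) (x : EuclideanSpace ℝ (Fin n)) : ℝ := ψ (‖x‖ ^ 2)

lemma sm_rad {ψ : ℝ → ℝ} (hψ : ContDiff ℝ (⊤ : ℕ∞) ψ) : Sm17 (rad17 ψ : EuclideanSpace ℝ (Fin n) → ℝ) :=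
  hψ.comp (contDiff_norm_sq ℝ)

lemma cs_rad {ψ : ℝ → ℝ} (hψ : HasCompactSupport ψ) :
    HasCompactSupport (rad17 ψ : EuclideanSpace ℝ (Fin n) → ℝ) := by
  obtain ⟨R, hR⟩ := hψ.isCompact.isBounded.subset_closedBall (0 : ℝ)
  refine HasCompactSupport.intro (isCompact_closedBall (0 : EuclideanSpace ℝ (Fin n)) (1 + |R|)) ?_
  intro x hx
  by_contra hne
  have h1 := hR (subset_tsupport _ (Function.mem_support.2 hne))
  simp at h1 hx
  have := le_abs_self R
  nlinarith [abs_nonneg R]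

lemma pd_rad {ψ : ℝ → ℝ} (hψ : ContDiff ℝ (⊤ : ℕ∞) ψ) (i : Fin n) :
    partialDeriv' i (rad17 ψ : EuclideanSpace ℝ (Fin n) → ℝ) = fun x => 2 * (x i * rad17 (deriv ψ) x) := by
  funext x
  unfold partialDeriv'
  have h1 : HasDerivAt ψ (deriv ψ (‖x‖ ^ 2)) (‖x‖ ^ 2) :=
    (hψ.differentiable (by simp) _).hasDerivAt
  have h2 := h1.comp_hasFDerivAt x (hasStrictFDerivAt_norm_sq x).hasFDerivAt
  have h3 : fderiv ℝ (rad17 ψ : EuclideanSpace ℝ (Fin n) → ℝ) x = _ := h2.fderiv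
  rw [h3]
  simp [rad17, EuclideanSpace.inner_single_right]; ring

lemma sm_deriv {ψ : ℝ → ℝ} (hψ : ContDiff ℝ (⊤ : ℕ∞) ψ) : ContDiff ℝ (⊤ : ℕ∞) (deriv ψ) := by
  exact ((contDiff_infty_iff_deriv (𝕜 := ℝ)).1 hψ).2

lemma ibp {f g : EuclideanSpace ℝ (Fin n) → ℝ} (hf : Sm17 f) (hg : Sm17 g) (hc : HasCompactSupport g)
    (i : Fin n) : ∫ x, g x * partialDeriv' i f x = - ∫ x, f x * partialDeriv' i g x := by
  have := integral_mul_fderiv_eq_neg_fderiv_mul_of_integrable (μ := (volume : Measure (EuclideanSpace ℝ (Fin n))))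
    (f := g) (g := f) (v := EuclideanSpace.single i 1) ?_ ?_ ?_ (fun x _ => hg.differentiable (by simp) x) (fun x _ => hf.differentiable (by simp) x)
  · unfold partialDeriv'
    rw [this]; simp [mul_comm]
  · exact (((sm_pd hg i).continuous).mul hf.continuous).integrable_of_hasCompactSupport ((cs_pd hc i).mul_right)
  · exact (hg.continuous.mul (sm_pd hf i).continuous).integrable_of_hasCompactSupport hc.mul_right
  · exact (hg.continuous.mul hf.continuous).integrable_of_hasCompactSupport hc.mul_right

lemma int_cs {f g : EuclideanSpace ℝ (Fin n) → ℝ} (hf : Sm17 f) (hg : Sm17 g) (hc : HasCompactSupport g) :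
    Integrable (fun x => g x * f x) :=
  (hg.continuous.mul hf.continuous).integrable_of_hasCompactSupport hc.mul_right

lemma ibp2 {f g : EuclideanSpace ℝ (Fin n) → ℝ} (hf : Sm17 f) (hg : Sm17 g) (hc : HasCompactSupport g)
    (i j : Fin n) : ∫ x, g x * partialDeriv' i (partialDeriv' j f) x =
      ∫ x, f x * partialDeriv' j (partialDeriv' i g) x := by
  rw [ibp (sm_pd hf j) hg hc i]
  simp_rw [mul_comm (partialDeriv' j f _)]
  rw [ibp hf (sm_pd hg i) (cs_pd hc i) j, neg_neg]

def Orth17 (G : EuclideanSpace ℝ (Fin n) → ℝ) : Prop :=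
  ∀ ψ : ℝ → ℝ, ContDiff ℝ (⊤ : ℕ∞) ψ → HasCompactSupport ψ →
    (∫ x, rad17 ψ x * G x = 0) ∧ ∀ l, ∫ x, (x l * rad17 ψ x) * G x = 0

lemma orth_ball {G : EuclideanSpace ℝ (Fin n) → ℝ} (hG : Continuous G) (r : ℝ) (hr : 0 < r)
    (H : ∀ ψ : ℝ → ℝ, ContDiff ℝ (⊤ : ℕ∞) ψ → HasCompactSupport ψ → ∫ x, rad17 ψ x * G x = 0) :
    ∫ x in Metric.ball (0 : EuclideanSpace ℝ (Fin n)) r, G x = 0 := by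
  have hr2 : 0 < r ^ 2 := by positivity
  have hpos : ∀ m : ℕ, 0 < r ^ 2 * (1 - 1 / ((m : ℝ) + 2)) := fun m => by
    apply mul_pos hr2
    rw [sub_pos, div_lt_one (by positivity)]; linarith [(Nat.cast_nonneg m : (0:ℝ) ≤ m)]
  have hlt : ∀ m : ℕ, r ^ 2 * (1 - 1 / ((m : ℝ) + 2)) < r ^ 2 := fun m => by
    have : 0 < 1 / ((m : ℝ) + 2) := by positivity
    nlinarith
  let ψ : ∀ m : ℕ, ContDiffBump (0 : ℝ) := fun m => ⟨_, _, hpos m, hlt m⟩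
  rw [← integral_indicator Metric.isOpen_ball.measurableSet]
  have key : Filter.Tendsto (fun m : ℕ => ∫ x, rad17 (ψ m) x * G x) Filter.atTop
      (nhds (∫ x, (Metric.ball (0 : EuclideanSpace ℝ (Fin n)) r).indicator G x)) := by
    apply tendsto_integral_of_dominated_convergence
      ((Metric.ball (0 : EuclideanSpace ℝ (Fin n)) r).indicator (fun x => |G x|))
    · intro m
      exact ((sm_rad (ψ m).contDiff).continuous.mul hG).aestronglyMeasurable
    · rw [integrable_indicator_iff Metric.isOpen_ball.measurableSet]
      exact (hG.abs.continuousOn.integrableOn_compact (isCompact_closedBall _ r)).mono_set Metric.ball_subset_closedBall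
    · intro m
      refine Filter.Eventually.of_forall fun x => ?_
      by_cases hx : x ∈ Metric.ball (0 : EuclideanSpace ℝ (Fin n)) r
      · rw [Set.indicator_of_mem hx, norm_mul, Real.norm_eq_abs, Real.norm_eq_abs]
        have : |rad17 (ψ m) x| ≤ 1 := by
          rw [rad17, abs_of_nonneg (ψ m).nonneg]; exact (ψ m).le_one
        nlinarith [abs_nonneg (G x)]
      · rw [Set.indicator_of_notMem hx]
        have : rad17 (ψ m) x = 0 := by
          apply (ψ m).zero_of_le_dist
          simp at hx ⊢
          show r ^ 2 ≤ _
          gcongr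
        simp [this]
    · refine Filter.Eventually.of_forall fun x => ?_
      by_cases hx : x ∈ Metric.ball (0 : EuclideanSpace ℝ (Fin n)) r
      · rw [Set.indicator_of_mem hx]
        apply tendsto_nhds_of_eventually_eq
        have hx' : ‖x‖ ^ 2 < r ^ 2 := by
          simp at hx; gcongr
        have hl : Filter.Tendsto (fun m : ℕ => r ^ 2 * (1 - 1 / ((m : ℝ) + 2))) Filter.atTop (nhds (r ^ 2 * (1 - 0))) := by
          apply Filter.Tendsto.const_mul
          apply Filter.Tendsto.const_sub
          have := (tendsto_one_div_add_atTop_nhds_zero_nat (𝕜 := ℝ)).comp (Filter.tendsto_add_atTop_nat 1)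
          refine this.congr fun m => ?_
          simp; ring
        have := hl.eventually (lt_mem_nhds (a := ‖x‖ ^ 2) (by simpa using hx'))
        filter_upwards [this] with m hm
        have : rad17 (ψ m) x = 1 := by
          apply (ψ m).one_of_mem_closedBall
          simp
          exact hm.le
        simp [this]
      · rw [Set.indicator_of_notMem hx]
        apply tendsto_nhds_of_eventually_eq
        refine Filter.Eventually.of_forall fun m => ?_
        have : rad17 (ψ m) x = 0 := by
          apply (ψ m).zero_of_le_dist
          simp at hx ⊢
          show r ^ 2 ≤ _
          gcongr
        simp [this]
  have h0 : ∀ m, ∫ x, rad17 (ψ m) x * G x = 0 := fun m => H _ (ψ m).contDiff (ψ m).hasCompactSupport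
  simp_rw [h0] at key
  exact (tendsto_nhds_unique key tendsto_const_nhds)

lemma Orth17.ball {G : EuclideanSpace ℝ (Fin n) → ℝ} (hG : Continuous G) (H : Orth17 G) (r : ℝ) (hr : 0 < r) (l : Fin n) :
    (∫ x in Metric.ball (0 : EuclideanSpace ℝ (Fin n)) r, G x = 0) ∧
    (∫ x in Metric.ball (0 : EuclideanSpace ℝ (Fin n)) r, x l * G x = 0) := by
  refine ⟨orth_ball hG r hr fun ψ h1 h2 => (H ψ h1 h2).1,
    orth_ball ((sm_coord l).continuous.mul hG) r hr fun ψ h1 h2 => ?_⟩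
  rw [← (H ψ h1 h2).2 l]
  congr 1; funext x; simp only [Pi.mul_apply]; ring

lemma pd2_rad {ψ : ℝ → ℝ} (hψ : ContDiff ℝ (⊤ : ℕ∞) ψ) (i j : Fin n) :
    partialDeriv' j (partialDeriv' i (rad17 ψ : EuclideanSpace ℝ (Fin n) → ℝ)) =
      fun x => 2 * ((if j = i then 1 else 0) * rad17 (deriv ψ) x)
        + 4 * (x i * x j * rad17 (deriv (deriv ψ)) x) := by
  have h1 := sm_deriv hψ
  rw [pd_rad hψ, pd_mul contDiff_const ((sm_coord i).mul (sm_rad h1)), pd_const,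
    pd_mul (sm_coord i) (sm_rad h1), pd_coord, pd_rad h1]
  funext x
  ring

lemma pd_crad {ψ : ℝ → ℝ} (hψ : ContDiff ℝ (⊤ : ℕ∞) ψ) (l i : Fin n) :
    partialDeriv' i (fun x : EuclideanSpace ℝ (Fin n) => x l * rad17 ψ x) =
      fun x => (if i = l then 1 else 0) * rad17 ψ x + x l * partialDeriv' i (rad17 ψ) x := by
  rw [pd_mul (sm_coord l) (sm_rad hψ), pd_coord]

lemma pd2_crad {ψ : ℝ → ℝ} (hψ : ContDiff ℝ (⊤ : ℕ∞) ψ) (l i j : Fin n) :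
    partialDeriv' j (partialDeriv' i (fun x : EuclideanSpace ℝ (Fin n) => x l * rad17 ψ x)) =
      fun x => (if i = l then 1 else 0) * (2 * (x j * rad17 (deriv ψ) x))
        + (if j = l then 1 else 0) * (2 * (x i * rad17 (deriv ψ) x))
        + x l * (2 * ((if j = i then 1 else 0) * rad17 (deriv ψ) x)
        + 4 * (x i * x j * rad17 (deriv (deriv ψ)) x)) := by
  have h1 := sm_rad (n := n) hψ
  rw [pd_crad hψ, pd_add (contDiff_const.mul h1) ((sm_coord l).mul (sm_pd h1 i)),
    pd_mul contDiff_const h1, pd_mul (sm_coord l) (sm_pd h1 i), pd_const, pd_coord, pd2_rad hψ,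
    pd_rad hψ, pd_rad hψ]
  funext x
  ring

lemma sum_sq17 (x : EuclideanSpace ℝ (Fin n)) : ∑ k, x k * x k = ‖x‖ ^ 2 := by
  rw [EuclideanSpace.real_norm_sq_eq]; simp [sq]

lemma orth_F (h : EuclideanSpace ℝ (Fin n) → Fin n → Fin n → ℝ) (hsm : ∀ i j, Sm17 (fun y => h y i j))
    (hsymm : ∀ x i j, h x i j = h x j i)
    (hann : ∀ (x : EuclideanSpace ℝ (Fin n)) (i : Fin n), ∑ j, h x i j * x j = 0)
    (htr : ∀ x : EuclideanSpace ℝ (Fin n), ∑ i, h x i i = 0) :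
    Orth17 (fun x => ∑ i, ∑ j, partialDeriv' i (partialDeriv' j (fun y => h y i j)) x) := by
  have main : ∀ g : EuclideanSpace ℝ (Fin n) → ℝ, Sm17 g → HasCompactSupport g →
      (∀ x, ∑ i, ∑ j, h x i j * partialDeriv' j (partialDeriv' i g) x = 0) →
      ∫ x, g x * (∑ i, ∑ j, partialDeriv' i (partialDeriv' j (fun y => h y i j)) x) = 0 := by
    intro g hg hc H
    simp_rw [Finset.mul_sum]
    have hi : ∀ i j, Integrable (fun x => h x i j * partialDeriv' j (partialDeriv' i g) x) := fun i j => by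
      simpa [mul_comm] using int_cs (hsm i j) (sm_pd (sm_pd hg i) j) (cs_pd (cs_pd hc i) j)
    have hi' : ∀ i j, Integrable (fun x => g x * partialDeriv' i (partialDeriv' j (fun y => h y i j)) x) :=
      fun i j => int_cs (sm_pd (sm_pd (hsm i j) j) i) hg hc
    rw [integral_finsetSum _ fun i _ => integrable_finsetSum _ fun j _ => hi' i j]
    simp_rw [integral_finsetSum _ fun j _ => hi' _ j]
    simp_rw [fun i j => ibp2 (hsm i j) hg hc i j]
    simp_rw [← integral_finsetSum Finset.univ fun j _ => hi _ j]
    rw [← integral_finsetSum _ fun i _ => integrable_finsetSum _ fun j _ => hi i j]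
    simp [H]
  have hann' : ∀ (x : EuclideanSpace ℝ (Fin n)) (j : Fin n), ∑ i, h x i j * x i = 0 := by
    intro x j; rw [← hann x j]; exact Finset.sum_congr rfl fun i _ => by rw [hsymm]
  have hA : ∀ (x : EuclideanSpace ℝ (Fin n)) (c : ℝ), ∑ i, ∑ j, h x i j * (x i * x j * c) = 0 := by
    intro x c
    apply Finset.sum_eq_zero; intro i _
    have : ∑ j, h x i j * (x i * x j * c) = (x i * c) * ∑ j, h x i j * x j := by
      rw [Finset.mul_sum]; exact Finset.sum_congr rfl fun j _ => by ring
    rw [this, hann, mul_zero]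
  have hB : ∀ (x : EuclideanSpace ℝ (Fin n)) (c : ℝ),
      ∑ i, ∑ j, h x i j * ((if j = i then 1 else 0) * c) = 0 := by
    intro x c
    simp [← Finset.sum_mul, htr]
  have hC : ∀ (x : EuclideanSpace ℝ (Fin n)) (l : Fin n) (c : ℝ),
      ∑ i, ∑ j, h x i j * ((if i = l then 1 else 0) * (x j * c)) = 0 := by
    intro x l c
    rw [Finset.sum_comm]
    simp [← mul_assoc, ← Finset.sum_mul, hann]
  have hD : ∀ (x : EuclideanSpace ℝ (Fin n)) (l : Fin n) (c : ℝ),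
      ∑ i, ∑ j, h x i j * ((if j = l then 1 else 0) * (x i * c)) = 0 := by
    intro x l c
    simp [← mul_assoc, ← Finset.sum_mul, hann']
  intro ψ hψ hc
  refine ⟨main _ (sm_rad hψ) (cs_rad hc) fun x => ?_, fun l =>
    main _ ((sm_coord l).mul (sm_rad hψ)) ((cs_rad hc).mul_left) fun x => ?_⟩
  · have e := congrArg₂ (· + ·) (hA x (4 * rad17 (deriv (deriv ψ)) x)) (hB x (2 * rad17 (deriv ψ) x))
    simp only [← Finset.sum_add_distrib, add_zero] at e
    rw [← e]
    refine Finset.sum_congr rfl fun i _ => Finset.sum_congr rfl fun j _ => ?_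
    rw [pd2_rad hψ]; ring
  · have e1 := hA x (4 * x l * rad17 (deriv (deriv ψ)) x)
    have e2 := hB x (2 * x l * rad17 (deriv ψ) x)
    have e3 := hC x l (2 * rad17 (deriv ψ) x)
    have e4 := hD x l (2 * rad17 (deriv ψ) x)
    have e := congrArg₂ (· + ·) (congrArg₂ (· + ·) e1 e2) (congrArg₂ (· + ·) e3 e4)
    simp only [← Finset.sum_add_distrib, add_zero] at e
    rw [← e]
    refine Finset.sum_congr rfl fun i _ => Finset.sum_congr rfl fun j _ => ?_
    rw [pd2_crad hψ]; ring

lemma sm_euler {G : EuclideanSpace ℝ (Fin n) → ℝ} (hG : Sm17 G) :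
    Sm17 (fun x => ∑ k, x k * partialDeriv' k G x) :=
  ContDiff.sum fun k _ => (sm_coord k).mul (sm_pd hG k)

lemma sm_lap {G : EuclideanSpace ℝ (Fin n) → ℝ} (hG : Sm17 G) :
    Sm17 (euclideanLaplacian G) :=
  ContDiff.sum fun k _ => sm_pd (sm_pd hG k) k

lemma test17 {ψ χ : ℝ → ℝ} (hψ : ContDiff ℝ (⊤ : ℕ∞) ψ) (hc : HasCompactSupport ψ)
    (hχ : ContDiff ℝ (⊤ : ℕ∞) χ) (hc' : HasCompactSupport χ) (a b : ℝ) :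
    ContDiff ℝ (⊤ : ℕ∞) (fun t => a * ψ t + b * t * χ t) ∧
    HasCompactSupport (fun t => a * ψ t + b * t * χ t) :=
  ⟨(contDiff_const.mul hψ).add ((contDiff_const.mul contDiff_id).mul hχ),
    (hc.mul_left (f := fun _ => a)).add (hc'.mul_left (f := fun t => b * t))⟩

lemma orth_euler {G : EuclideanSpace ℝ (Fin n) → ℝ} (hG : Sm17 G) (H : Orth17 G) :
    Orth17 (fun x => ∑ k, x k * partialDeriv' k G x) := by
  have main : ∀ g : EuclideanSpace ℝ (Fin n) → ℝ, Sm17 g → HasCompactSupport g →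
      ∫ x, g x * (∑ k, x k * partialDeriv' k G x) =
       - ∫ x, (∑ k, (g x + x k * partialDeriv' k g x)) * G x := by
    intro g hg hc
    simp_rw [Finset.mul_sum, Finset.sum_mul]
    have hs : ∀ k, Sm17 (fun x => x k * g x) := fun k => (sm_coord k).mul hg
    have hcs : ∀ k : Fin n, HasCompactSupport (fun x : EuclideanSpace ℝ (Fin n) => x k * g x) :=
      fun k => hc.mul_left
    have e : ∀ k, partialDeriv' k (fun x => x k * g x) = fun x => g x + x k * partialDeriv' k g x := by
      intro k; rw [pd_mul (sm_coord k) hg, pd_coord]; simp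
    have i1 : ∀ k, Integrable (fun x => g x * (x k * partialDeriv' k G x)) := fun k =>
      int_cs ((sm_coord k).mul (sm_pd hG k)) hg hc
    have i2 : ∀ k, Integrable (fun x => (g x + x k * partialDeriv' k g x) * G x) := fun k => by
      have := int_cs hG (sm_pd (hs k) k) (cs_pd (hcs k) k)
      rwa [e] at this
    rw [integral_finsetSum _ fun k _ => i1 k, integral_finsetSum _ fun k _ => i2 k,
      ← Finset.sum_neg_distrib]
    refine Finset.sum_congr rfl fun k _ => ?_
    have := ibp hG (hs k) (hcs k) k
    rw [e] at this
    simp_rw [mul_comm _ (G _)]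
    rw [← this]
    congr 1; funext x; ring
  intro ψ hψ hc
  constructor
  · rw [main _ (sm_rad hψ) (cs_rad hc), neg_eq_zero]
    obtain ⟨t1, t2⟩ := test17 hψ hc (sm_deriv hψ) hc.deriv n 2
    rw [← (H _ t1 t2).1]
    congr 1; funext x; congr 1
    have : ∀ k, x k * partialDeriv' k (rad17 ψ) x = (x k * x k) * (2 * rad17 (deriv ψ) x) := by
      intro k; rw [pd_rad hψ]; ring
    simp_rw [Finset.sum_add_distrib, this, ← Finset.sum_mul, sum_sq17]
    simp [rad17]; ring
  · intro l
    rw [main _ ((sm_coord l).mul (sm_rad hψ)) ((cs_rad hc).mul_left), neg_eq_zero]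
    obtain ⟨t1, t2⟩ := test17 hψ hc (sm_deriv hψ) hc.deriv (n + 1) 2
    rw [← (H _ t1 t2).2 l]
    congr 1; funext x; congr 1
    have : ∀ k, x k * partialDeriv' k (fun x => x l * rad17 ψ x) x =
        (if k = l then x k * rad17 ψ x else 0) + (x k * x k) * (x l * (2 * rad17 (deriv ψ) x)) := by
      intro k; rw [pd_crad hψ, pd_rad hψ]; split_ifs <;> ring
    simp_rw [Finset.sum_add_distrib]
    simp_rw [this, Finset.sum_add_distrib, ← Finset.sum_mul, sum_sq17]
    simp [rad17]; ring

lemma orth_lap {G : EuclideanSpace ℝ (Fin n) → ℝ} (hG : Sm17 G) (H : Orth17 G) :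
    Orth17 (euclideanLaplacian G) := by
  have main : ∀ g : EuclideanSpace ℝ (Fin n) → ℝ, Sm17 g → HasCompactSupport g →
      ∫ x, g x * euclideanLaplacian G x =
       ∫ x, (∑ k, partialDeriv' k (partialDeriv' k g) x) * G x := by
    intro g hg hc
    simp_rw [euclideanLaplacian, Finset.mul_sum, Finset.sum_mul]
    rw [integral_finsetSum _ fun k _ => int_cs (sm_pd (sm_pd hG k) k) hg hc,
      integral_finsetSum _ fun k _ => int_cs hG (sm_pd (sm_pd hg k) k) (cs_pd (cs_pd hc k) k)]
    refine Finset.sum_congr rfl fun k _ => ?_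
    rw [ibp2 hG hg hc]
    simp_rw [mul_comm]
  intro ψ hψ hc
  constructor
  · rw [main _ (sm_rad hψ) (cs_rad hc)]
    obtain ⟨t1, t2⟩ := test17 (sm_deriv hψ) hc.deriv (sm_deriv (sm_deriv hψ)) hc.deriv.deriv (2 * n) 4
    rw [← (H _ t1 t2).1]
    congr 1; funext x; congr 1
    have : ∀ k, partialDeriv' k (partialDeriv' k (rad17 ψ)) x =
        2 * rad17 (deriv ψ) x + (x k * x k) * (4 * rad17 (deriv (deriv ψ)) x) := by
      intro k; rw [pd2_rad hψ]; simp; ring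
    simp_rw [this, Finset.sum_add_distrib, ← Finset.sum_mul, sum_sq17]
    simp [rad17]; ring
  · intro l
    rw [main _ ((sm_coord l).mul (sm_rad hψ)) ((cs_rad hc).mul_left)]
    obtain ⟨t1, t2⟩ := test17 (sm_deriv hψ) hc.deriv (sm_deriv (sm_deriv hψ)) hc.deriv.deriv (4 + 2 * n) 4
    rw [← (H _ t1 t2).2 l]
    congr 1; funext x; congr 1
    have : ∀ k, partialDeriv' k (partialDeriv' k (fun x => x l * rad17 ψ x)) x =
        (if k = l then 4 * (x k * rad17 (deriv ψ) x) else 0) + 2 * (x l * rad17 (deriv ψ) x)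
          + (x k * x k) * (x l * (4 * rad17 (deriv (deriv ψ)) x)) := by
      intro k; rw [pd2_crad hψ]; simp only [if_true]; split_ifs <;> ring
    have e : (∑ k, partialDeriv' k (partialDeriv' k (fun x => x l * rad17 ψ x)) x) = _ :=
      Finset.sum_congr rfl fun k _ => this k
    refine e.trans ?_
    simp_rw [Finset.sum_add_distrib, ← Finset.sum_mul, sum_sq17]
    simp [rad17]; ring

end

/-- For a smooth symmetric, position-annihilating, trace-free two-tensor `h`
on `ℝⁿ` and `F = ∑ᵢⱼ ∂ᵢ∂ⱼ h_{ij}`, the integrals over every ball `B_r(0)` of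
`F`, `x_l·F`, `∑ₖ xₖ∂ₖF`, `x_l·∑ₖ xₖ∂ₖF`, `ΔF` and `x_l·ΔF` all vanish. -/
theorem stmt_17 (n : ℕ) (hn : 2 ≤ n)
    (h : EuclideanSpace ℝ (Fin n) → Fin n → Fin n → ℝ) (hsm : ContDiff ℝ (⊤ : ℕ∞) h)
    (hsymm : ∀ x i j, h x i j = h x j i)
    (hann : ∀ (x : EuclideanSpace ℝ (Fin n)) (i : Fin n), ∑ j, h x i j * x j = 0)
    (htr : ∀ x : EuclideanSpace ℝ (Fin n), ∑ i, h x i i = 0)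
    (F : EuclideanSpace ℝ (Fin n) → ℝ)
    (hF : F = fun x => ∑ i, ∑ j, partialDeriv' i (partialDeriv' j (fun y => h y i j)) x) :
    ∀ r : ℝ, 0 < r → ∀ l : Fin n,
      (∫ x in Metric.ball (0 : EuclideanSpace ℝ (Fin n)) r, F x = 0) ∧
      (∫ x in Metric.ball (0 : EuclideanSpace ℝ (Fin n)) r, x l * F x = 0) ∧
      (∫ x in Metric.ball (0 : EuclideanSpace ℝ (Fin n)) r,
        (∑ k, x k * partialDeriv' k F x) = 0) ∧
      (∫ x in Metric.ball (0 : EuclideanSpace ℝ (Fin n)) r,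
        x l * (∑ k, x k * partialDeriv' k F x) = 0) ∧
      (∫ x in Metric.ball (0 : EuclideanSpace ℝ (Fin n)) r, euclideanLaplacian F x = 0) ∧
      (∫ x in Metric.ball (0 : EuclideanSpace ℝ (Fin n)) r, x l * euclideanLaplacian F x = 0) := by
  have hsm' : ∀ i j, Sm17 (fun y => h y i j) := fun i j =>
    contDiff_pi.1 (contDiff_pi.1 hsm i) j
  have hFs : Sm17 F := by
    rw [hF]
    exact ContDiff.sum fun i _ => ContDiff.sum fun j _ => sm_pd (sm_pd (hsm' i j) j) i
  have hO : Orth17 F := by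
    rw [hF]; exact orth_F h hsm' hsymm hann htr
  intro r hr l
  obtain ⟨a1, a2⟩ := hO.ball hFs.continuous r hr l
  obtain ⟨a3, a4⟩ := (orth_euler hFs hO).ball (sm_euler hFs).continuous r hr l
  obtain ⟨a5, a6⟩ := (orth_lap hFs hO).ball (sm_lap hFs).continuous r hr l
  exact ⟨a1, a2, a3, a4, a5, a6⟩
end
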